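/- Let K = F_5(z)[y]/(y^2 + 4z^6+2z^5+3z^3+4z^2+1) be the quadratic function field over F_5(z) obtained by adjoining a root y of the irreducible polynomial Y^2 + (4z^6+2z^5+3z^3+4z^2+1). Then the Artin–Schreier polynomial T^5 + 4T + ((4z^3+z^2+3z+4)y + z^6+3z^5+4z^2+2z+3)/(z+3), in the variable T with coefficients in K, is irreducible over K. (This quintic defines the record curve of genus 10 with 31 rational points over F_5.) -/

import Mathlib

open Polynomial

instance : Fact (Nat.Prime 5) := ⟨by norm_num⟩

/-- `z` denotes the generator `Z` of the rational function field `F₅(z)`. -/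
noncomputable def z : RatFunc (ZMod 5) := RatFunc.X

/-- The defining polynomial `Y² + (4z⁶+2z⁵+3z³+4z²+1)` of the genus-2 base field over `F₅`. -/
noncomputable def p : Polynomial (RatFunc (ZMod 5)) :=
  X ^ 2 + C (4 * z ^ 6 + 2 * z ^ 5 + 3 * z ^ 3 + 4 * z ^ 2 + 1)

/-- The image of `z` in `K = F₅(z)[y]/(p)`. -/
noncomputable def zK : AdjoinRoot p := AdjoinRoot.of p z

/-- The adjoined root `y` in `K = F₅(z)[y]/(p)`. -/
noncomputable def y : AdjoinRoot p := AdjoinRoot.root p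

theorem irreducible_X_pow_sub_X_sub_C {F : Type*} [Field F] (q : ℕ) [Fact q.Prime] [CharP F q]
    (a : F) (ha : ∀ x : F, x ^ q - x ≠ a) : Irreducible (X ^ q - X - C a : F[X]) := by
  have hq : 1 < q := (Fact.out : q.Prime).one_lt
  have hlt : (X + C a : F[X]).degree < q := by
    rw [degree_X_add_C]
    exact_mod_cast hq
  have hmonic : (X ^ q - X - C a : F[X]).Monic := by
    rw [sub_sub]
    exact monic_X_pow_sub hlt
  have hdeg : (X ^ q - X - C a : F[X]).natDegree = q := by
    rw [sub_sub]
    apply natDegree_eq_of_degree_eq_some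
    rw [degree_sub_eq_left_of_degree_lt (by rwa [degree_X_pow]), degree_X_pow]
  have hunit : ¬ IsUnit (X ^ q - X - C a : F[X]) := fun h => by
    have := natDegree_eq_zero_of_isUnit h
    omega
  obtain ⟨g, hg, hirr, hdvd⟩ := exists_monic_irreducible_factor _ hunit
  obtain hle | hgt := le_or_gt q g.natDegree
  · rwa [eq_of_monic_of_dvd_of_natDegree_le hg hmonic hdvd (hdeg.trans_le hle)]
  exfalso
  let L := AlgebraicClosure F
  have : CharP L q := charP_of_injective_algebraMap (algebraMap F L).injective q
  have hsplit : (g.map (algebraMap F L)).Splits := IsAlgClosed.splits _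
  have hroots : ∀ r ∈ (g.map (algebraMap F L)).roots, r ^ q - r = algebraMap F L a := by
    intro r hr
    have h0 : aeval r (X ^ q - X - C a : F[X]) = 0 := by
      apply aeval_eq_zero_of_dvd_aeval_eq_zero hdvd
      rw [aeval_def, ← eval_map]
      exact (mem_roots'.1 hr).2
    simpa [sub_eq_zero] using h0
  have hcard : (g.map (algebraMap F L)).roots.card = g.natDegree := by
    rw [← hsplit.natDegree_eq_card_roots, natDegree_map]
  obtain ⟨α, hα⟩ : ∃ α, α ∈ (g.map (algebraMap F L)).roots :=
    Multiset.card_pos_iff_exists_mem.1 (hcard ▸ hirr.natDegree_pos)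
  have hdiff : ((g.map (algebraMap F L)).roots.map fun r => r - α).sum ∈
      (algebraMap F L).fieldRange := by
    refine multiset_sum_mem _ fun b hb => ?_
    obtain ⟨r, hr, rfl⟩ := Multiset.mem_map.1 hb
    refine (bot_le : (⊥ : Subfield L) ≤ _) ((Subfield.mem_bot_iff_pow_eq_self L q).2 ?_)
    rw [sub_pow_char]
    linear_combination hroots r hr - hroots α hα
  have hsum : (g.map (algebraMap F L)).roots.sum ∈ (algebraMap F L).fieldRange := by
    have h := hsplit.nextCoeff_eq_neg_sum_roots_of_monic (hg.map _)
    rw [nextCoeff_map (algebraMap F L).injective] at h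
    exact ⟨-g.nextCoeff, by rw [map_neg, h, neg_neg]⟩
  have hmul : (g.natDegree : L) * α ∈ (algebraMap F L).fieldRange := by
    rw [Multiset.sum_map_sub, Multiset.map_id', Multiset.map_const', Multiset.sum_replicate,
      hcard, nsmul_eq_mul] at hdiff
    simpa using sub_mem hsum hdiff
  have hne : (g.natDegree : L) ≠ 0 := by
    rw [Ne, CharP.cast_eq_zero_iff L q]
    exact Nat.not_dvd_of_pos_of_lt hirr.natDegree_pos hgt
  have hmem : α ∈ (algebraMap F L).fieldRange := by
    have := mul_mem (inv_mem (natCast_mem (algebraMap F L).fieldRange g.natDegree)) hmul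
    rwa [inv_mul_cancel_left₀ hne] at this
  obtain ⟨x, rfl⟩ := hmem
  refine ha x ((algebraMap F L).injective ?_)
  simpa using hroots _ hα

theorem RatFunc.pow_sub_self_ne_div {F : Type*} [Field F] {π g : F[X]} (hπ : Prime π)
    (hg : ¬ π ∣ g) {k : ℕ} (hk : 2 ≤ k) (s : RatFunc F) :
    s ^ k - s ≠ algebraMap F[X] (RatFunc F) g / algebraMap F[X] (RatFunc F) π := by
  intro h
  obtain ⟨m, rfl⟩ : ∃ m, k = m + 2 := ⟨k - 2, by omega⟩
  have hinj := IsFractionRing.injective F[X] (RatFunc F)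
  have hD : algebraMap F[X] (RatFunc F) s.denom ≠ 0 := by
    simpa using s.denom_ne_zero
  have hπ' : algebraMap F[X] (RatFunc F) π ≠ 0 := by simpa using hπ.ne_zero
  have key : π * (s.num ^ (m + 2) - s.num * s.denom ^ (m + 1)) = g * s.denom ^ (m + 2) := by
    apply hinj
    have hs : algebraMap F[X] (RatFunc F) s.num = s * algebraMap F[X] (RatFunc F) s.denom :=
      (div_eq_iff hD).1 s.num_div_denom
    rw [eq_div_iff hπ'] at h
    simp only [map_mul, map_sub, map_pow, hs]
    linear_combination algebraMap F[X] (RatFunc F) s.denom ^ (m + 2) * h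
  have hdenom : π ∣ s.denom :=
    hπ.dvd_of_dvd_pow ((hπ.dvd_or_dvd (Dvd.intro _ key)).resolve_left hg)
  obtain ⟨e, he⟩ := hdenom
  have hnum : π ∣ s.num := by
    have h2 : s.num ^ (m + 2) - s.num * s.denom ^ (m + 1) =
        g * π ^ (m + 1) * e ^ (m + 2) := by
      apply mul_left_cancel₀ hπ.ne_zero
      rw [key, he]
      ring
    refine hπ.dvd_of_dvd_pow (n := m + 2)
      ⟨s.num * e * s.denom ^ m + g * π ^ m * e ^ (m + 2), ?_⟩
    linear_combination h2 + s.num * s.denom ^ m * he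
  exact hπ.not_isUnit (s.isCoprime_num_denom.isUnit_of_dvd' hnum ⟨e, he⟩)

theorem p_natDegree : p.natDegree = 2 := by
  unfold p
  compute_degree!

theorem p_monic : p.Monic := by
  unfold p
  monicity!

theorem exists_eq_of_add_of_mul_y (w : AdjoinRoot p) :
    ∃ u v : RatFunc (ZMod 5), w = AdjoinRoot.of p u + AdjoinRoot.of p v * y := by
  obtain ⟨h, rfl⟩ := AdjoinRoot.mk_surjective w
  have hlt : (h %ₘ p).natDegree < 2 := by
    rw [← p_natDegree]
    exact natDegree_modByMonic_lt _ p_monic fun h1 => by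
      simpa [h1] using p_natDegree
  obtain ⟨v, u, huv⟩ := exists_eq_X_add_C_of_natDegree_le_one (Nat.le_of_lt_succ hlt)
  refine ⟨u, v, ?_⟩
  rw [← AdjoinRoot.mk_leftInverse p_monic (AdjoinRoot.mk p h), AdjoinRoot.modByMonicHom_mk, huv]
  simp [y, add_comm]

theorem eq_zero_of_of_add_of_mul_y_eq_zero {u v : RatFunc (ZMod 5)}
    (h : AdjoinRoot.of p u + AdjoinRoot.of p v * y = 0) : u = 0 := by
  have h1 : AdjoinRoot.mk p (C v * X + C u) = 0 := by
    rw [← h]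
    simp [y, add_comm]
  have h2 : (C v * X + C u : (RatFunc (ZMod 5))[X]) = 0 := by
    by_contra hne
    refine AdjoinRoot.mk_ne_zero_of_natDegree_lt p_monic hne ?_ h1
    rw [p_natDegree]
    exact Nat.lt_succ_of_le natDegree_linear_le
  simpa using congrArg (coeff · 0) h2

theorem y_sq : y ^ 2 = -AdjoinRoot.of p (4 * z ^ 6 + 2 * z ^ 5 + 3 * z ^ 3 + 4 * z ^ 2 + 1) := by
  have h : AdjoinRoot.mk p (X ^ 2 + C _) = 0 := AdjoinRoot.mk_self
  rw [map_add, map_pow, AdjoinRoot.mk_X, AdjoinRoot.mk_C] at h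
  exact eq_neg_of_add_eq_zero_left h

theorem z_pow_five_sub_self_ne (u : RatFunc (ZMod 5)) :
    u ^ 5 - u ≠ -((z ^ 6 + 3 * z ^ 5 + 4 * z ^ 2 + 2 * z + 3) / (z + 3)) := by
  have hπ : Prime (X - C 2 : (ZMod 5)[X]) := prime_X_sub_C 2
  have hg : ¬ (X - C 2 : (ZMod 5)[X]) ∣ -(X ^ 6 + 3 * X ^ 5 + 4 * X ^ 2 + 2 * X + 3) := by
    rw [dvd_iff_isRoot]
    simp only [IsRoot, eval_neg, eval_add, eval_mul, eval_pow, eval_X, eval_ofNat]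
    decide
  convert RatFunc.pow_sub_self_ne_div hπ hg (by norm_num : 2 ≤ 5) u using 1
  have h3 : (X - C 2 : (ZMod 5)[X]) = X + 3 := by
    rw [sub_eq_add_neg, ← C_neg, show (-2 : ZMod 5) = 3 from rfl]
    rfl
  rw [h3, ← neg_div]
  simp [z, RatFunc.algebraMap_X, map_ofNat]

/-- Assuming `p` is irreducible (so that `K = AdjoinRoot p` is the quadratic function field
`F₅(z)(y)`, a field in which we may divide by the nonzero element `z+3`), the Artin–Schreier
polynomial `T⁵ + 4T + ((4z³+z²+3z+4)y + z⁶+3z⁵+4z²+2z+3)/(z+3)` is irreducible over `K`. -/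
theorem stmt_17 [Fact (Irreducible p)] :
    Irreducible (X ^ 5 + C (4 : AdjoinRoot p) * X +
      C (((4 * zK ^ 3 + zK ^ 2 + 3 * zK + 4) * y +
          zK ^ 6 + 3 * zK ^ 5 + 4 * zK ^ 2 + 2 * zK + 3) / (zK + 3))) := by
  have : CharP (AdjoinRoot p) 5 :=
    charP_of_injective_algebraMap (algebraMap (ZMod 5) (AdjoinRoot p)).injective 5
  have h5 : (5 : AdjoinRoot p) = 0 := by exact_mod_cast CharP.cast_eq_zero (AdjoinRoot p) 5
  have hz : z + 3 ≠ 0 := by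
    have h := RatFunc.algebraMap_ne_zero (X_add_C_ne_zero (3 : ZMod 5))
    simpa [z, map_ofNat] using h
  have hzK : zK + 3 ≠ 0 := by
    have h := (map_ne_zero (AdjoinRoot.of p)).2 hz
    simpa [zK, map_ofNat] using h
  set a := ((4 * zK ^ 3 + zK ^ 2 + 3 * zK + 4) * y +
    zK ^ 6 + 3 * zK ^ 5 + 4 * zK ^ 2 + 2 * zK + 3) / (zK + 3) with ha
  have hpoly : (X ^ 5 + C (4 : AdjoinRoot p) * X + C a) = X ^ 5 - X - C (-a) := by
    rw [show (4 : AdjoinRoot p) = -1 by linear_combination h5, C_neg, C_neg, C_1]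
    ring
  rw [hpoly]
  refine irreducible_X_pow_sub_X_sub_C 5 (-a) fun w hw => ?_
  obtain ⟨u, v, rfl⟩ := exists_eq_of_add_of_mul_y w
  have ha' : a = AdjoinRoot.of p ((4 * z ^ 3 + z ^ 2 + 3 * z + 4) / (z + 3)) * y +
      AdjoinRoot.of p ((z ^ 6 + 3 * z ^ 5 + 4 * z ^ 2 + 2 * z + 3) / (z + 3)) := by
    rw [ha]
    simp only [map_div₀, map_add, map_mul, map_pow, map_ofNat,
      show AdjoinRoot.of p z = zK from rfl]
    field_simp
    ring
  have hy : y ^ 5 = AdjoinRoot.of p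
      ((4 * z ^ 6 + 2 * z ^ 5 + 3 * z ^ 3 + 4 * z ^ 2 + 1) ^ 2) * y := by
    rw [map_pow, ← neg_sq, ← y_sq]
    ring
  rw [ha', add_pow_char, mul_pow, hy] at hw
  refine z_pow_five_sub_self_ne u (eq_neg_of_add_eq_zero_left
    (eq_zero_of_of_add_of_mul_y_eq_zero (v := v ^ 5 *
      (4 * z ^ 6 + 2 * z ^ 5 + 3 * z ^ 3 + 4 * z ^ 2 + 1) ^ 2 - v +
      (4 * z ^ 3 + z ^ 2 + 3 * z + 4) / (z + 3)) ?_))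
  simp only [map_add (AdjoinRoot.of p) (_ - _), map_sub, map_mul (AdjoinRoot.of p) (_ ^ 5),
    map_pow (AdjoinRoot.of p) _ 5]
  linear_combination hw
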